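/- arXiv:2604.07418 — 3 statements merged into one kernel-verified Lean document; each statement's English description precedes it below -/
import Mathlib

section
/- Let p be a positive real number. Then the identity |x·cos θ − y·sin θ|^p + |x·sin θ + y·cos θ|^p = |x|^p + |y|^p holds for all real θ, x, y if and only if p = 2. -/
/-- For a positive real exponent `p`, planar rotations preserve the
`p`-th-power weight sum `|x| ^ p + |y| ^ p` for all angles and vectors
iff `p = 2`. -/
theorem rotation_preserves_p_weight_iff (p : ℝ) (hp : 0 < p) :
    (∀ θ x y : ℝ,
        |x * Real.cos θ - y * Real.sin θ| ^ p +
          |x * Real.sin θ + y * Real.cos θ| ^ p = |x| ^ p + |y| ^ p) ↔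
      p = 2 := by
  constructor
  · intro h
    have h1 := h (Real.pi / 4) 1 1
    have h2 : |√2| ^ p = 2 := by
      simpa [Real.zero_rpow hp.ne', one_add_one_eq_two] using h1
    rw [abs_of_nonneg (Real.sqrt_nonneg 2), Real.sqrt_eq_rpow,
      ← Real.rpow_mul zero_le_two] at h2
    have h3 : (2 : ℝ) ^ (1 / 2 * p) = 2 ^ (1 : ℝ) := by rw [h2, Real.rpow_one]
    rw [Real.rpow_right_inj zero_lt_two (by norm_num)] at h3
    linarith
  · rintro rfl θ x y
    simp only [Real.rpow_two, sq_abs]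
    linear_combination (x ^ 2 + y ^ 2) * Real.sin_sq_add_cos_sq θ
end

section
/- Let p ≥ 1 with p ≠ 2, and let T : ℝ² → ℝ² be a linear map such that |T(v)₀|^p + |T(v)₁|^p = |v₀|^p + |v₁|^p for every v ∈ ℝ². Then T is a signed coordinate permutation: there exist ε₀, ε₁ ∈ {−1, 1} such that either T(v) = (ε₀·v₀, ε₁·v₁) for all v, or T(v) = (ε₀·v₁, ε₁·v₀) for all v. -/
theorem Real.add_rpow_lt_rpow_add_of_one_lt {q A B : ℝ} (hq : 1 < q) (hA : 0 < A) (hB : 0 < B) :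
    A ^ q + B ^ q < (A + B) ^ q := by
  have split (x : ℝ) (hx : 0 < x) : x ^ q = x * x ^ (q - 1) := by
    rw [← Real.rpow_one_add' hx.le (by linarith)]; ring_nf
  rw [split A hA, split B hB, split (A + B) (by positivity), add_mul]
  have hq' : 0 < q - 1 := by linarith
  gcongr <;> linarith

theorem Real.rpow_add_lt_add_rpow_of_lt_one {q A B : ℝ} (hq₀ : 0 < q) (hq : q < 1)
    (hA : 0 < A) (hB : 0 < B) :
    (A + B) ^ q < A ^ q + B ^ q := by
  have split (x : ℝ) (hx : 0 < x) : x ^ q = x * x ^ (q - 1) := by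
    rw [← Real.rpow_one_add' hx.le (by linarith)]; ring_nf
  rw [split A hA, split B hB, split (A + B) (by positivity), add_mul]
  exact add_lt_add
    (mul_lt_mul_of_pos_left (Real.rpow_lt_rpow_of_neg hA (by linarith) (by linarith)) hA)
    (mul_lt_mul_of_pos_left (Real.rpow_lt_rpow_of_neg hB (by linarith) (by linarith)) hB)

theorem Real.abs_rpow_eq_sq_rpow_half (x p : ℝ) : |x| ^ p = (x ^ 2) ^ (p / 2) := by
  rw [← sq_abs, ← Real.rpow_natCast_mul (abs_nonneg x)]
  congr 1
  push_cast
  ring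

/-- Clarkson's inequality for `p > 2` and two nonzero reals. -/
theorem Real.two_mul_add_abs_rpow_lt {p z w : ℝ} (hp : 2 < p) (hz : z ≠ 0) (hw : w ≠ 0) :
    2 * (|z| ^ p + |w| ^ p) < |z + w| ^ p + |z - w| ^ p := by
  simp only [Real.abs_rpow_eq_sq_rpow_half _ p]
  have h₁ := Real.add_rpow_lt_rpow_add_of_one_lt (q := p / 2) (by linarith)
    (sq_pos_of_ne_zero hz) (sq_pos_of_ne_zero hw)
  have h₂ := (convexOn_rpow (p := p / 2) (by linarith)).2
    (Set.mem_Ici.2 (sq_nonneg (z + w))) (Set.mem_Ici.2 (sq_nonneg (z - w)))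
    (by norm_num : (0 : ℝ) ≤ 1 / 2) (by norm_num : (0 : ℝ) ≤ 1 / 2) (by norm_num)
  simp only [smul_eq_mul] at h₂
  rw [show 1 / 2 * (z + w) ^ 2 + 1 / 2 * (z - w) ^ 2 = z ^ 2 + w ^ 2 by ring] at h₂
  linarith

/-- Clarkson's inequality for `0 < p < 2` and two nonzero reals. -/
theorem Real.abs_rpow_lt_two_mul_add {p z w : ℝ} (hp₀ : 0 < p) (hp : p < 2)
    (hz : z ≠ 0) (hw : w ≠ 0) :
    |z + w| ^ p + |z - w| ^ p < 2 * (|z| ^ p + |w| ^ p) := by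
  simp only [Real.abs_rpow_eq_sq_rpow_half _ p]
  have h₁ := Real.rpow_add_lt_add_rpow_of_lt_one (q := p / 2) (by linarith) (by linarith)
    (sq_pos_of_ne_zero hz) (sq_pos_of_ne_zero hw)
  have h₂ := (Real.concaveOn_rpow (p := p / 2) (by linarith) (by linarith)).2
    (Set.mem_Ici.2 (sq_nonneg (z + w))) (Set.mem_Ici.2 (sq_nonneg (z - w)))
    (by norm_num : (0 : ℝ) ≤ 1 / 2) (by norm_num : (0 : ℝ) ≤ 1 / 2) (by norm_num)
  simp only [smul_eq_mul] at h₂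
  rw [show 1 / 2 * (z + w) ^ 2 + 1 / 2 * (z - w) ^ 2 = z ^ 2 + w ^ 2 by ring] at h₂
  linarith

theorem Real.abs_add_rpow_add_abs_sub_rpow_of_mul_eq_zero {z w : ℝ} (p : ℝ) (hp : p ≠ 0)
    (h : z * w = 0) : |z + w| ^ p + |z - w| ^ p = 2 * (|z| ^ p + |w| ^ p) := by
  rcases mul_eq_zero.1 h with rfl | rfl <;> simp [Real.zero_rpow hp] <;> ring

/-- Equality in the sum of two instances of Clarkson's inequality forces both to be degenerate. -/
theorem Real.mul_eq_zero_of_clarkson_eq {p a b c d : ℝ} (hp₀ : 0 < p) (hp2 : p ≠ 2)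
    (h : |a + b| ^ p + |a - b| ^ p + (|c + d| ^ p + |c - d| ^ p) =
      2 * (|a| ^ p + |b| ^ p) + 2 * (|c| ^ p + |d| ^ p)) :
    a * b = 0 ∧ c * d = 0 := by
  have eq {z w : ℝ} := Real.abs_add_rpow_add_abs_sub_rpow_of_mul_eq_zero (z := z) (w := w) p hp₀.ne'
  rcases lt_or_gt_of_ne hp2 with hp | hp
  · have lt {z w : ℝ} (hzw : z * w ≠ 0) := Real.abs_rpow_lt_two_mul_add hp₀ hp
      (left_ne_zero_of_mul hzw) (right_ne_zero_of_mul hzw)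
    by_cases hab : a * b = 0 <;> by_cases hcd : c * d = 0
    · exact ⟨hab, hcd⟩
    · linarith [eq hab, lt hcd]
    · linarith [lt hab, eq hcd]
    · linarith [lt hab, lt hcd]
  · have lt {z w : ℝ} (hzw : z * w ≠ 0) := Real.two_mul_add_abs_rpow_lt hp
      (left_ne_zero_of_mul hzw) (right_ne_zero_of_mul hzw)
    by_cases hab : a * b = 0 <;> by_cases hcd : c * d = 0
    · exact ⟨hab, hcd⟩
    · linarith [eq hab, lt hcd]
    · linarith [lt hab, eq hcd]
    · linarith [lt hab, lt hcd]

/-- Finite-dimensional real Lamperti theorem in two coordinates: for `p ≥ 1`,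
`p ≠ 2`, a linear map on `ℝ²` preserving the `p`-th-power weight sum is a
signed coordinate permutation. -/
theorem lamperti_dim_two (p : ℝ) (hp : 1 ≤ p) (hp2 : p ≠ 2)
    (T : (Fin 2 → ℝ) →ₗ[ℝ] (Fin 2 → ℝ))
    (hT : ∀ v : Fin 2 → ℝ,
      |T v 0| ^ p + |T v 1| ^ p = |v 0| ^ p + |v 1| ^ p) :
    ∃ ε₀ ε₁ : ℝ, (ε₀ = 1 ∨ ε₀ = -1) ∧ (ε₁ = 1 ∨ ε₁ = -1) ∧
      ((∀ v : Fin 2 → ℝ, T v 0 = ε₀ * v 0 ∧ T v 1 = ε₁ * v 1) ∨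
        (∀ v : Fin 2 → ℝ, T v 0 = ε₀ * v 1 ∧ T v 1 = ε₁ * v 0)) := by
  have hp₀ : 0 < p := by linarith
  obtain ⟨a, b, c, d, hTv⟩ : ∃ a b c d : ℝ, ∀ v : Fin 2 → ℝ,
      T v 0 = a * v 0 + b * v 1 ∧ T v 1 = c * v 0 + d * v 1 := by
    refine ⟨T ![1, 0] 0, T ![0, 1] 0, T ![1, 0] 1, T ![0, 1] 1, fun v => ?_⟩
    have hv : v = v 0 • ![1, 0] + v 1 • ![0, 1] := by
      ext i; fin_cases i <;> simp
    have hTv : T v = v 0 • T ![1, 0] + v 1 • T ![0, 1] := by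
      rw [← map_smul, ← map_smul, ← map_add, ← hv]
    simp [hTv, mul_comm]
  have hxy (x y : ℝ) :
      |a * x + b * y| ^ p + |c * x + d * y| ^ p = |x| ^ p + |y| ^ p := by
    simpa [hTv] using hT ![x, y]
  have hac : |a| ^ p + |c| ^ p = 1 := by simpa [Real.zero_rpow hp₀.ne'] using hxy 1 0
  have hbd : |b| ^ p + |d| ^ p = 1 := by simpa [Real.zero_rpow hp₀.ne'] using hxy 0 1
  have hadd : |a + b| ^ p + |c + d| ^ p = 1 + 1 := by simpa using hxy 1 1
  have hsub : |a - b| ^ p + |c - d| ^ p = 1 + 1 := by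
    simpa [← sub_eq_add_neg] using hxy 1 (-1)
  obtain ⟨hab, hcd⟩ := Real.mul_eq_zero_of_clarkson_eq (a := a) (b := b) (c := c) (d := d)
    hp₀ hp2 (by linarith)
  have sign {x : ℝ} (hx : |x| ^ p = 1) : x = 1 ∨ x = -1 :=
    eq_or_eq_neg_of_abs_eq
      ((Real.rpow_left_inj (abs_nonneg x) zero_le_one hp₀.ne').1 (by rw [hx, Real.one_rpow]))
  have ne_zero {x : ℝ} (hx : |x| ^ p = 1) : x ≠ 0 := by
    rintro rfl
    simp [Real.zero_rpow hp₀.ne'] at hx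
  rcases mul_eq_zero.1 hab with rfl | rfl
  · have hc : |c| ^ p = 1 := by simpa [Real.zero_rpow hp₀.ne'] using hac
    obtain rfl : d = 0 := (mul_eq_zero.1 hcd).resolve_left (ne_zero hc)
    have hb : |b| ^ p = 1 := by simpa [Real.zero_rpow hp₀.ne'] using hbd
    exact ⟨b, c, sign hb, sign hc, .inr fun v => by simpa using hTv v⟩
  · have hd : |d| ^ p = 1 := by simpa [Real.zero_rpow hp₀.ne'] using hbd
    obtain rfl : c = 0 := (mul_eq_zero.1 hcd).resolve_right (ne_zero hd)
    have ha : |a| ^ p = 1 := by simpa [Real.zero_rpow hp₀.ne'] using hac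
    exact ⟨a, d, sign ha, sign hd, .inl fun v => by simpa using hTv v⟩
end

section
/- Let n be a natural number, let p ≥ 1 with p ≠ 2, and let T : (Fin n → ℝ) → (Fin n → ℝ) be a linear map such that ∑ᵢ |T(v) i|^p = ∑ᵢ |v i|^p for every v. Then T is a signed coordinate permutation: there exist a permutation σ of Fin n and signs ε : Fin n → ℝ with ε i ∈ {−1, 1} for every i, such that T(v) i = ε i · v (σ i) for all v and all i. -/
theorem Real.rpow_add_rpow_lt_add_rpow {a b q : ℝ} (ha : 0 < a) (hb : 0 < b) (hq : 1 < q) :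
    a ^ q + b ^ q < (a + b) ^ q := by
  have split : ∀ x : ℝ, 0 < x → x ^ q = x * x ^ (q - 1) := fun x hx => by
    rw [Real.rpow_sub_one hx.ne', mul_div_cancel₀ _ hx.ne']
  have h1 : a ^ (q - 1) < (a + b) ^ (q - 1) :=
    Real.rpow_lt_rpow ha.le (by linarith) (by linarith)
  have h2 : b ^ (q - 1) < (a + b) ^ (q - 1) :=
    Real.rpow_lt_rpow hb.le (by linarith) (by linarith)
  rw [split a ha, split b hb, split (a + b) (by linarith), add_mul]
  gcongr

theorem Real.add_rpow_lt_rpow_add_rpow {a b q : ℝ} (ha : 0 < a) (hb : 0 < b) (hq : q < 1) :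
    (a + b) ^ q < a ^ q + b ^ q := by
  have split : ∀ x : ℝ, 0 < x → x ^ q = x * x ^ (q - 1) := fun x hx => by
    rw [Real.rpow_sub_one hx.ne', mul_div_cancel₀ _ hx.ne']
  have h1 : (a + b) ^ (q - 1) < a ^ (q - 1) :=
    Real.rpow_lt_rpow_of_neg ha (by linarith) (by linarith)
  have h2 : (a + b) ^ (q - 1) < b ^ (q - 1) :=
    Real.rpow_lt_rpow_of_neg hb (by linarith) (by linarith)
  rw [split a ha, split b hb, split (a + b) (by linarith), add_mul]
  gcongr

/-- Strict scalar Clarkson inequality for exponents above two. -/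
theorem Real.clarkson_lt_of_two_lt {a b p : ℝ} (hp : 2 < p) (ha : a ≠ 0) (hb : b ≠ 0) :
    2 * (|a| ^ p + |b| ^ p) < |a + b| ^ p + |a - b| ^ p := by
  simp only [Real.abs_rpow_eq_sq_rpow_half]
  have h1 := Real.rpow_add_rpow_lt_add_rpow (a := a ^ 2) (b := b ^ 2) (q := p / 2)
    (by positivity) (by positivity) (by linarith)
  have h2 := (convexOn_rpow (p := p / 2) (by linarith)).2
    (Set.mem_Ici.2 (sq_nonneg (a + b))) (Set.mem_Ici.2 (sq_nonneg (a - b)))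
    (show (0 : ℝ) ≤ 1 / 2 by norm_num) (show (0 : ℝ) ≤ 1 / 2 by norm_num) (by norm_num)
  simp only [smul_eq_mul] at h2
  rw [show 1 / 2 * (a + b) ^ 2 + 1 / 2 * (a - b) ^ 2 = a ^ 2 + b ^ 2 by ring] at h2
  linarith

/-- Strict scalar Clarkson inequality for nonnegative exponents below two. -/
theorem Real.clarkson_lt_of_lt_two {a b p : ℝ} (hp0 : 0 ≤ p) (hp : p < 2)
    (ha : a ≠ 0) (hb : b ≠ 0) :
    |a + b| ^ p + |a - b| ^ p < 2 * (|a| ^ p + |b| ^ p) := by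
  simp only [Real.abs_rpow_eq_sq_rpow_half]
  have h1 := Real.add_rpow_lt_rpow_add_rpow (a := a ^ 2) (b := b ^ 2) (q := p / 2)
    (by positivity) (by positivity) (by linarith)
  have h2 := (Real.concaveOn_rpow (p := p / 2) (by linarith) (by linarith)).2
    (Set.mem_Ici.2 (sq_nonneg (a + b))) (Set.mem_Ici.2 (sq_nonneg (a - b)))
    (show (0 : ℝ) ≤ 1 / 2 by norm_num) (show (0 : ℝ) ≤ 1 / 2 by norm_num) (by norm_num)
  simp only [smul_eq_mul] at h2
  rw [show 1 / 2 * (a + b) ^ 2 + 1 / 2 * (a - b) ^ 2 = a ^ 2 + b ^ 2 by ring] at h2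
  linarith

/-- Equality in the summed Clarkson inequality forces disjoint supports. -/
theorem Finset.mul_eq_zero_of_sum_clarkson_eq {ι : Type*} {s : Finset ι} {p : ℝ} (hp : 0 < p)
    (hp2 : p ≠ 2) {f g : ι → ℝ}
    (h : ∑ i ∈ s, (|f i + g i| ^ p + |f i - g i| ^ p) =
      ∑ i ∈ s, 2 * (|f i| ^ p + |g i| ^ p)) {i : ι} (hi : i ∈ s) :
    f i * g i = 0 := by
  have degenerate : ∀ j, f j = 0 ∨ g j = 0 →
      |f j + g j| ^ p + |f j - g j| ^ p = 2 * (|f j| ^ p + |g j| ^ p) := by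
    rintro j (hj | hj) <;> simp [hj, Real.zero_rpow hp.ne', two_mul]
  by_contra hne
  obtain ⟨hf, hg⟩ := mul_ne_zero_iff.1 hne
  rcases lt_or_gt_of_ne hp2 with hlt | hgt
  · refine (Finset.sum_lt_sum (fun j _ => ?_)
      ⟨i, hi, Real.clarkson_lt_of_lt_two hp.le hlt hf hg⟩).ne h
    by_cases hj : f j = 0 ∨ g j = 0
    · exact (degenerate j hj).le
    · rw [not_or] at hj
      exact (Real.clarkson_lt_of_lt_two hp.le hlt hj.1 hj.2).le
  · refine (Finset.sum_lt_sum (fun j _ => ?_)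
      ⟨i, hi, Real.clarkson_lt_of_two_lt hgt hf hg⟩).ne' h
    by_cases hj : f j = 0 ∨ g j = 0
    · exact (degenerate j hj).ge
    · rw [not_or] at hj
      exact (Real.clarkson_lt_of_two_lt hgt hj.1 hj.2).le

/-- Finite-dimensional real Lamperti theorem: for `p ≥ 1`, `p ≠ 2`, a linear
map on `ℝⁿ` preserving the `p`-th-power weight sum is a signed coordinate
permutation. -/
theorem lamperti_real (n : ℕ) (p : ℝ) (hp : 1 ≤ p) (hp2 : p ≠ 2)
    (T : (Fin n → ℝ) →ₗ[ℝ] (Fin n → ℝ))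
    (hT : ∀ v : Fin n → ℝ, ∑ i, |T v i| ^ p = ∑ i, |v i| ^ p) :
    ∃ (σ : Equiv.Perm (Fin n)) (ε : Fin n → ℝ),
      (∀ i, ε i = 1 ∨ ε i = -1) ∧
        ∀ (v : Fin n → ℝ) (i : Fin n), T v i = ε i * v (σ i) := by
  have hp0 : 0 < p := by linarith
  let e : Fin n → Fin n → ℝ := fun j => Pi.single j 1
  have disjoint : ∀ j k, j ≠ k → ∀ i, T (e j) i * T (e k) i = 0 := by
    intro j k hjk i
    refine Finset.mul_eq_zero_of_sum_clarkson_eq hp0 hp2 (s := Finset.univ) ?_ (Finset.mem_univ i)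
    have hadd := hT (e j + e k)
    have hsub := hT (e j - e k)
    simp only [map_add, map_sub, Pi.add_apply, Pi.sub_apply] at hadd hsub
    rw [Finset.sum_add_distrib, hadd, hsub, ← Finset.mul_sum, Finset.sum_add_distrib, hT, hT,
      ← Finset.sum_add_distrib, ← Finset.sum_add_distrib, Finset.mul_sum]
    refine Finset.sum_congr rfl fun l _ => ?_
    have hl : e j l = 0 ∨ e k l = 0 := by
      by_cases hlj : l = j
      · exact .inr (Pi.single_eq_of_ne (hlj ▸ hjk) _)
      · exact .inl (Pi.single_eq_of_ne hlj _)
    rcases hl with hl | hl <;> simp [hl, Real.zero_rpow hp0.ne', two_mul]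
  have norm_col : ∀ j, ∑ i, |T (e j) i| ^ p = 1 := by
    intro j
    rw [hT, Finset.sum_eq_single j]
    · simp [e]
    · intro i _ hij
      simp [e, hij, Real.zero_rpow hp0.ne']
    · simp
  have exists_ne : ∀ j, ∃ i, T (e j) i ≠ 0 := by
    intro j
    by_contra! h
    simpa [h, Real.zero_rpow hp0.ne'] using norm_col j
  choose f hf using exists_ne
  have f_inj : Function.Injective f := by
    intro j k hjk
    by_contra hne
    have hk := hf k
    rw [← hjk] at hk
    exact mul_ne_zero (hf j) hk (disjoint j k hne (f j))
  let F : Equiv.Perm (Fin n) := Equiv.ofBijective f (Finite.injective_iff_bijective.1 f_inj)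
  have off_diag : ∀ i j, j ≠ F.symm i → T (e j) i = 0 := by
    intro i j hj
    have h := disjoint j (F.symm i) hj i
    have hi : T (e (F.symm i)) i ≠ 0 := by
      have := hf (F.symm i)
      rwa [show f (F.symm i) = i from F.apply_symm_apply i] at this
    exact (mul_eq_zero.1 h).resolve_right hi
  refine ⟨F.symm, fun i => T (e (F.symm i)) i, fun i => ?_, fun v i => ?_⟩
  · have h := norm_col (F.symm i)
    rw [Finset.sum_eq_single i] at h
    · rw [← Real.one_rpow p, Real.rpow_left_inj (abs_nonneg _) zero_le_one hp0.ne'] at h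
      exact eq_or_eq_neg_of_abs_eq h
    · intro k _ hk
      rw [off_diag k (F.symm i) (fun h => hk (F.symm.injective h).symm), abs_zero,
        Real.zero_rpow hp0.ne']
    · simp
  · have hv : v = ∑ j, v j • e j := by
      ext k
      simp [e, Pi.single_apply]
    conv_lhs => rw [hv]
    simp only [map_sum, map_smul, Finset.sum_apply, Pi.smul_apply, smul_eq_mul]
    rw [Finset.sum_eq_single (F.symm i), mul_comm]
    · intro j _ hj
      rw [off_diag i j hj, mul_zero]
    · simp
end
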